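/- Let X = {x_1,…,x_{2n}} be a set of 2n variables over a field F, let π be a permutation of [2n], and let s ≤ n be a natural number.ditionSuppose f ∈ F[X] can be written as f = Σ_{v=1}^m g_v · h_v, where for each v, either (i) every variable occurring in g_v lies in {x_{π(1)},…,x_{π(n)}} and h_v depends on at most 2s variables, or (ii) every variable occurring in h_v lies in {x_{π(n+1)},…,x_{π(2n)}} and g_v depends on at most 2s variables. Let A be the bijective partition renaming {x_{π(1)},…,x_{π(n)}} to Y-variables and {x_{π(n+1)},…,x_{π(2n)}} to Z-variables, and let f^A be f after this renaming. Then maxrank(M_{f^A}) ≤ m · 2^s. In particular, if maxrank(M_{f^A}) = 2^n (f is full max-rank for this partition), then m ≥ 2^{n−s}. -/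

import Mathlib

open scoped Classical

noncomputable section

namespace PCM

variable {F : Type} [Field F] {Y Z : Type} [Fintype Y] [Fintype Z]

/-- Exponent vector of the monic multilinear monomial `∏_{y ∈ p} y · ∏_{z ∈ q} z`. -/
def mexp (p : Finset Y) (q : Finset Z) : (Y ⊕ Z) →₀ ℕ :=
  (∑ y ∈ p, Finsupp.single (Sum.inl y) 1) + ∑ z ∈ q, Finsupp.single (Sum.inr z) 1

/-- The polynomial coefficient matrix `M_f`. -/
def coeffMatrix (f : MvPolynomial (Y ⊕ Z) F) :
    Matrix (Finset Y) (Finset Z) (MvPolynomial (Y ⊕ Z) F) := fun p q =>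
  ∑ d ∈ f.support,
    if d.support ⊆ p.image Sum.inl ∪ q.image Sum.inr ∧ mexp p q ≤ d then
      MvPolynomial.monomial (d - mexp p q) (MvPolynomial.coeff d f)
    else 0

/-- `maxrank(M_f)`: the maximum, over substitutions `S`, of the rank of `M_f|_S`. -/
def maxrank (f : MvPolynomial (Y ⊕ Z) F) : ℕ :=
  ⨆ S : (Y ⊕ Z) → F, ((coeffMatrix f).map (MvPolynomial.eval S)).rank

/-- The partial derivatives matrix `L_f`. -/
def pdMatrix (f : MvPolynomial (Y ⊕ Z) F) : Matrix (Finset Y) (Finset Z) F := fun p q =>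
  MvPolynomial.coeff (mexp p q) f

end PCM

namespace PABP

/-- The bijective partition `A` determined by the permutation `π` of the `2n`
variables: `x_{π(i)}` is renamed to the `Y`-variable `y_i` for `i < n`, and to the
`Z`-variable `z_{i-n}` for `n ≤ i < 2n`. -/
def partA (n : ℕ) (π : Equiv.Perm (Fin (2 * n))) : Fin (2 * n) → Fin n ⊕ Fin n :=
  fun v =>
    if h : ((π.symm v : Fin (2 * n)) : ℕ) < n then
      Sum.inl ⟨((π.symm v : Fin (2 * n)) : ℕ), h⟩
    else
      Sum.inr ⟨((π.symm v : Fin (2 * n)) : ℕ) - n, by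
        have := (π.symm v).isLt; omega⟩

end PABP

namespace PCM

/-- The coefficient of the multilinear monomial `∏_{i ∈ p} x_i` in the reduction of `x ^ a`
modulo the relations `x_i ^ 2 = S_i x_i`. -/
def reducedCoeff {F ι : Type} [Field F] [Fintype ι] (S : ι → F) (p : Finset ι) (a : ι → ℕ) : F :=
  if p = Finset.univ.filter (fun i => a i ≠ 0) then ∏ i, S i ^ (a i - 1) else 0

section ReducedCoeff

variable {F ι : Type} [Field F] [Fintype ι]

lemma reducedCoeff_eq_zero (S : ι → F) {p : Finset ι} {a : ι → ℕ} {i : ι} (hi : i ∈ p)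
    (ha : a i = 0) : reducedCoeff S p a = 0 := by
  refine if_neg fun hp => ?_
  rw [hp] at hi
  simp [ha] at hi

lemma reducedCoeff_add (S : ι → F) (p T : Finset ι) (a b : ι → ℕ)
    (hb : ∀ i, b i ≠ 0 → i ∈ T) :
    reducedCoeff S p (a + b) = ∑ e ∈ T.powerset,
      reducedCoeff S p (a + fun i => if i ∈ e then 1 else 0) * reducedCoeff S e b := by
  rw [Finset.sum_eq_single (Finset.univ.filter fun i => b i ≠ 0)]
  · have hsupp : (Finset.univ.filter fun i =>
        (a + fun j => if j ∈ Finset.univ.filter (fun k => b k ≠ 0) then 1 else 0 : ι → ℕ) i ≠ 0) =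
        Finset.univ.filter fun i => (a + b) i ≠ 0 := by
      ext i
      by_cases h : b i = 0 <;> simp [h]
    unfold reducedCoeff
    rw [hsupp, if_pos (rfl : (Finset.univ.filter fun i => b i ≠ 0) = _), ite_mul, zero_mul,
      ← Finset.prod_mul_distrib]
    congr 1
    refine Finset.prod_congr rfl fun i _ => ?_
    rw [← pow_add]
    congr 1
    by_cases h : b i = 0
    · simp [h]
    · simp [h]
      omega
  · intro e _ he
    rw [reducedCoeff, reducedCoeff, if_neg he, mul_zero]
  · intro h
    refine absurd (Finset.mem_powerset.2 fun i hi => hb i ?_) h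
    simpa using hi

end ReducedCoeff

section Rank

variable {F : Type} [Field F]

lemma rank_le_card_of_eq_sum {P Q ι : Type} [Fintype P] [Fintype Q] (M : Matrix P Q F)
    (I : Finset ι) (u : P → ι → F) (v : ι → Q → F)
    (hM : ∀ p q, M p q = ∑ i ∈ I, u p i * v i q) : M.rank ≤ I.card := by
  have h : M = (Matrix.of fun p (i : I) => u p i) * (Matrix.of fun (i : I) q => v i q) := by
    ext p q
    rw [hM, Matrix.mul_apply, ← Finset.sum_coe_sort]
    rfl
  rw [h]
  refine (Matrix.rank_mul_le_left _ _).trans ((Matrix.rank_le_card_width _).trans ?_)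
  simp

lemma rank_add_le {P Q : Type} [Fintype P] [Fintype Q] (A B : Matrix P Q F) :
    (A + B).rank ≤ A.rank + B.rank := by
  refine (Submodule.finrank_mono ?_).trans (Submodule.finrank_add_le_finrank_add_finrank _ _)
  rintro _ ⟨x, rfl⟩
  rw [Matrix.mulVecLin_apply, Matrix.add_mulVec]
  exact Submodule.add_mem_sup (LinearMap.mem_range_self A.mulVecLin x)
    (LinearMap.mem_range_self B.mulVecLin x)

lemma rank_sum_le {P Q ι : Type} [Fintype P] [Fintype Q] (I : Finset ι) (M : ι → Matrix P Q F)
    (k : ℕ) (hM : ∀ i ∈ I, (M i).rank ≤ k) : (∑ i ∈ I, M i).rank ≤ I.card * k := by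
  induction I using Finset.induction_on with
  | empty => simp
  | insert i I hi ih =>
    rw [Finset.sum_insert hi, Finset.card_insert_of_notMem hi, add_mul, one_mul, add_comm]
    refine (rank_add_le _ _).trans (add_le_add ?_ ?_)
    · exact ih fun j hj => hM j (Finset.mem_insert_of_mem hj)
    · exact hM i (Finset.mem_insert_self _ _)

end Rank

section EvalMatrix

variable {F : Type} [Field F] {Y Z : Type}

lemma mexp_inl (p : Finset Y) (q : Finset Z) (y : Y) :
    mexp p q (Sum.inl y) = if y ∈ p then 1 else 0 := by
  simp [mexp, Finsupp.single_apply]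

lemma mexp_inr (p : Finset Y) (q : Finset Z) (z : Z) :
    mexp p q (Sum.inr z) = if z ∈ q then 1 else 0 := by
  simp [mexp, Finsupp.single_apply]

lemma mem_vars_of_ne_zero {f : MvPolynomial (Y ⊕ Z) F} {d : (Y ⊕ Z) →₀ ℕ} (hd : d ∈ f.support)
    {x : Y ⊕ Z} (hx : d x ≠ 0) : x ∈ f.vars :=
  (MvPolynomial.mem_vars_iff_mem_support x).2 ⟨d, hd, Finsupp.mem_support_iff.2 hx⟩

lemma mem_vars_or_of_mem_vars_mul {g h : MvPolynomial (Y ⊕ Z) F} {x : Y ⊕ Z} (hx : x ∈ (g * h).vars) :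
    x ∈ g.vars ∨ x ∈ h.vars :=
  Finset.mem_union.1 (MvPolynomial.vars_mul g h hx)

variable [Fintype Y] [Fintype Z]

/-- The `(p, q)` coefficient of the reduction of `x ^ d` modulo `x_i ^ 2 = S_i x_i`. -/
def weight (S : Y ⊕ Z → F) (p : Finset Y) (q : Finset Z) (d : (Y ⊕ Z) →₀ ℕ) : F :=
  reducedCoeff (fun y => S (Sum.inl y)) p (fun y => d (Sum.inl y)) *
    reducedCoeff (fun z => S (Sum.inr z)) q (fun z => d (Sum.inr z))

/-- The matrix `M_f|_S` as a function of `f`. -/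
def evalMatrix (S : Y ⊕ Z → F) (f : MvPolynomial (Y ⊕ Z) F) : Matrix (Finset Y) (Finset Z) F :=
  (coeffMatrix f).map (MvPolynomial.eval S)

/-- The linear functional on polynomials sending `x ^ d` to `weight S p q d`. -/
def weightMap (S : Y ⊕ Z → F) (p : Finset Y) (q : Finset Z) :
    MvPolynomial (Y ⊕ Z) F →ₗ[F] F :=
  (MvPolynomial.basisMonomials (Y ⊕ Z) F).constr F (weight S p q)

lemma weightMap_monomial (S : Y ⊕ Z → F) (p : Finset Y) (q : Finset Z) (d : (Y ⊕ Z) →₀ ℕ)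
    (c : F) : weightMap S p q (MvPolynomial.monomial d c) = c * weight S p q d := by
  have h : MvPolynomial.monomial d c = c • MvPolynomial.basisMonomials (Y ⊕ Z) F d := by
    simp [MvPolynomial.smul_monomial]
  rw [h, map_smul, weightMap, Module.Basis.constr_basis, smul_eq_mul]

lemma support_subset_and_mexp_le_iff (p : Finset Y) (q : Finset Z) (d : (Y ⊕ Z) →₀ ℕ) :
    (d.support ⊆ p.image Sum.inl ∪ q.image Sum.inr ∧ mexp p q ≤ d) ↔
      p = Finset.univ.filter (fun y => d (Sum.inl y) ≠ 0) ∧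
        q = Finset.univ.filter (fun z => d (Sum.inr z) ≠ 0) := by
  simp only [Finset.subset_iff, Finsupp.le_def, Sum.forall, mexp_inl, mexp_inr,
    Finset.ext_iff, Finset.mem_filter, Finset.mem_univ, true_and, Finset.mem_union,
    Finset.mem_image, Finsupp.mem_support_iff, Sum.inl.injEq, Sum.inr.injEq, exists_eq_right,
    reduceCtorEq, and_false, exists_false, or_false, false_or]
  grind

lemma evalMatrix_apply (S : Y ⊕ Z → F) (f : MvPolynomial (Y ⊕ Z) F) (p : Finset Y)
    (q : Finset Z) : evalMatrix S f p q = weightMap S p q f := by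
  conv_rhs => rw [f.as_sum]
  rw [map_sum, evalMatrix, Matrix.map_apply, coeffMatrix, map_sum]
  refine Finset.sum_congr rfl fun d _ => ?_
  rw [weightMap_monomial, weight, reducedCoeff, reducedCoeff]
  by_cases hc : d.support ⊆ p.image Sum.inl ∪ q.image Sum.inr ∧ mexp p q ≤ d
  · obtain ⟨hp, hq⟩ := (support_subset_and_mexp_le_iff p q d).1 hc
    rw [if_pos hc, if_pos hp, if_pos hq, MvPolynomial.eval_monomial,
      Finsupp.prod_fintype _ _ fun _ => pow_zero _, Fintype.prod_sum_type]
    congr 2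
    · refine Finset.prod_congr rfl fun y _ => ?_
      rw [Finsupp.tsub_apply, mexp_inl, hp]
      by_cases h : d (Sum.inl y) = 0 <;> simp [h]
    · refine Finset.prod_congr rfl fun z _ => ?_
      rw [Finsupp.tsub_apply, mexp_inr, hq]
      by_cases h : d (Sum.inr z) = 0 <;> simp [h]
  · rw [if_neg hc, map_zero]
    rw [support_subset_and_mexp_le_iff, not_and_or] at hc
    rcases hc with h | h <;> simp only [if_neg h, zero_mul, mul_zero]

lemma evalMatrix_sum {ι : Type} (S : Y ⊕ Z → F) (I : Finset ι)
    (f : ι → MvPolynomial (Y ⊕ Z) F) :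
    evalMatrix S (∑ i ∈ I, f i) = ∑ i ∈ I, evalMatrix S (f i) := by
  ext p q
  simp only [Matrix.sum_apply, evalMatrix_apply, map_sum]

/-- If the weights of products of monomials of `g` and `h` factor through an index set `I`,
then `M_{gh}|_S` has rank at most `|I|`. -/
lemma rank_evalMatrix_mul_le {ι : Type} (S : Y ⊕ Z → F) (g h : MvPolynomial (Y ⊕ Z) F)
    (I : Finset ι) (u : Finset Y → ι → ((Y ⊕ Z) →₀ ℕ) → F)
    (v : ι → Finset Z → ((Y ⊕ Z) →₀ ℕ) → F)
    (huv : ∀ a ∈ g.support, ∀ b ∈ h.support, ∀ p q,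
      weight S p q (a + b) = ∑ i ∈ I, u p i a * v i q b) :
    (evalMatrix S (g * h)).rank ≤ I.card := by
  refine rank_le_card_of_eq_sum _ I (fun p i => ∑ a ∈ g.support, g.coeff a * u p i a)
    (fun i q => ∑ b ∈ h.support, h.coeff b * v i q b) fun p q => ?_
  rw [evalMatrix_apply]
  conv_lhs => rw [g.as_sum, h.as_sum]
  simp only [Finset.sum_mul_sum, map_sum, MvPolynomial.monomial_mul, weightMap_monomial]
  rw [Finset.sum_comm' (t' := g.support) (s' := fun _ => I) (by simp)]
  refine Finset.sum_congr rfl fun a ha => ?_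
  rw [Finset.sum_comm]
  refine Finset.sum_congr rfl fun b hb => ?_
  rw [huv a ha b hb, Finset.mul_sum]
  exact Finset.sum_congr rfl fun i _ => by ring

lemma rank_evalMatrix_le_left (S : Y ⊕ Z → F) (f : MvPolynomial (Y ⊕ Z) F) (T : Finset Y)
    (hT : ∀ y, Sum.inl y ∈ f.vars → y ∈ T) : (evalMatrix S f).rank ≤ 2 ^ T.card := by
  rw [← one_mul f, ← Finset.card_powerset]
  refine rank_evalMatrix_mul_le S 1 f T.powerset (fun p e _ => if p = e then 1 else 0)
    (fun e q b => weight S e q b) fun a ha b hb p q => ?_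
  have ha0 : a = 0 := by
    by_contra h
    exact (MvPolynomial.mem_support_iff.1 ha) (by simp [MvPolynomial.coeff_one, Ne.symm h])
  simp only [ha0, zero_add, ite_mul, one_mul, zero_mul, Finset.sum_ite_eq, Finset.mem_powerset]
  split_ifs with hp
  · rfl
  · obtain ⟨y, hy, hyT⟩ := Finset.not_subset.1 hp
    rw [weight, reducedCoeff_eq_zero _ hy, zero_mul]
    by_contra h
    exact hyT (hT y (mem_vars_of_ne_zero hb h))

lemma rank_evalMatrix_le_right (S : Y ⊕ Z → F) (f : MvPolynomial (Y ⊕ Z) F) (T : Finset Z)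
    (hT : ∀ z, Sum.inr z ∈ f.vars → z ∈ T) : (evalMatrix S f).rank ≤ 2 ^ T.card := by
  rw [← mul_one f, ← Finset.card_powerset]
  refine rank_evalMatrix_mul_le S f 1 T.powerset (fun p e a => weight S p e a)
    (fun e q _ => if q = e then 1 else 0) fun a ha b hb p q => ?_
  have hb0 : b = 0 := by
    by_contra h
    exact (MvPolynomial.mem_support_iff.1 hb) (by simp [MvPolynomial.coeff_one, Ne.symm h])
  simp only [hb0, add_zero, mul_ite, mul_one, mul_zero, Finset.sum_ite_eq, Finset.mem_powerset]
  split_ifs with hq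
  · rfl
  · obtain ⟨z, hz, hzT⟩ := Finset.not_subset.1 hq
    rw [weight, reducedCoeff_eq_zero (fun z => S (Sum.inr z)) hz, mul_zero]
    by_contra h
    exact hzT (hT z (mem_vars_of_ne_zero ha h))

lemma rank_evalMatrix_mul_le_left (S : Y ⊕ Z → F) (g h : MvPolynomial (Y ⊕ Z) F) (T : Finset Y)
    (hg : ∀ z, Sum.inr z ∉ g.vars) (hT : ∀ y, Sum.inl y ∈ h.vars → y ∈ T) :
    (evalMatrix S (g * h)).rank ≤ 2 ^ T.card := by
  rw [← Finset.card_powerset]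
  refine rank_evalMatrix_mul_le S g h T.powerset
    (fun p e a => reducedCoeff (fun y => S (Sum.inl y)) p
      ((fun y => a (Sum.inl y)) + fun y => if y ∈ e then 1 else 0))
    (fun e q b => weight S e q b) fun a ha b hb p q => ?_
  have haz : (fun z => (a + b) (Sum.inr z)) = fun z => b (Sum.inr z) := by
    funext z
    have : a (Sum.inr z) = 0 := by
      by_contra hne
      exact hg z (mem_vars_of_ne_zero ha hne)
    simp [this]
  have key := reducedCoeff_add (fun y => S (Sum.inl y)) p T (fun y => a (Sum.inl y))
    (fun y => b (Sum.inl y)) fun y hy => hT y (mem_vars_of_ne_zero hb hy)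
  simp only [weight, haz, ← mul_assoc]
  rw [← Finset.sum_mul, ← key]
  rfl

lemma rank_evalMatrix_mul_le_right (S : Y ⊕ Z → F) (g h : MvPolynomial (Y ⊕ Z) F)
    (T : Finset Z) (hh : ∀ y, Sum.inl y ∉ h.vars) (hT : ∀ z, Sum.inr z ∈ g.vars → z ∈ T) :
    (evalMatrix S (g * h)).rank ≤ 2 ^ T.card := by
  rw [← Finset.card_powerset]
  refine rank_evalMatrix_mul_le S g h T.powerset (fun p e a => weight S p e a)
    (fun e q b => reducedCoeff (fun z => S (Sum.inr z)) q
      ((fun z => b (Sum.inr z)) + fun z => if z ∈ e then 1 else 0)) fun a ha b hb p q => ?_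
  have hby : (fun y => (a + b) (Sum.inl y)) = fun y => a (Sum.inl y) := by
    funext y
    have : b (Sum.inl y) = 0 := by
      by_contra hne
      exact hh y (mem_vars_of_ne_zero hb hne)
    simp [this]
  have key := reducedCoeff_add (fun z => S (Sum.inr z)) q T (fun z => b (Sum.inr z))
    (fun z => a (Sum.inr z)) fun z hz => hT z (mem_vars_of_ne_zero ha hz)
  have hcomm : (fun z => (a + b) (Sum.inr z)) =
      (fun z => b (Sum.inr z)) + fun z => a (Sum.inr z) := by
    funext z
    exact add_comm _ _
  simp only [weight, hby, hcomm]
  rw [key, Finset.mul_sum]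
  exact Finset.sum_congr rfl fun e _ => by ring

/-- If `g` involves only `Y`-variables and `h` depends on at most `2s` variables, then
`M_{gh}|_S` has rank at most `2 ^ s`. -/
lemma rank_evalMatrix_mul_le_of_inl (S : Y ⊕ Z → F) (g h : MvPolynomial (Y ⊕ Z) F) (s : ℕ)
    (hg : ∀ z, Sum.inr z ∉ g.vars) (hh : h.vars.card ≤ 2 * s) :
    (evalMatrix S (g * h)).rank ≤ 2 ^ s := by
  have hcard := h.vars.card_toLeft_add_card_toRight
  rcases le_or_gt h.vars.toLeft.card s with hs | hs
  · exact (rank_evalMatrix_mul_le_left S g h h.vars.toLeft hg (by simp)).trans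
      (Nat.pow_le_pow_right two_pos hs)
  · refine (rank_evalMatrix_le_right S (g * h) h.vars.toRight fun z hz => ?_).trans
      (Nat.pow_le_pow_right two_pos (by omega))
    exact Finset.mem_toRight.2 ((mem_vars_or_of_mem_vars_mul hz).resolve_left (hg z))

/-- If `h` involves only `Z`-variables and `g` depends on at most `2s` variables, then
`M_{gh}|_S` has rank at most `2 ^ s`. -/
lemma rank_evalMatrix_mul_le_of_inr (S : Y ⊕ Z → F) (g h : MvPolynomial (Y ⊕ Z) F) (s : ℕ)
    (hh : ∀ y, Sum.inl y ∉ h.vars) (hg : g.vars.card ≤ 2 * s) :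
    (evalMatrix S (g * h)).rank ≤ 2 ^ s := by
  have hcard := g.vars.card_toLeft_add_card_toRight
  rcases le_or_gt g.vars.toRight.card s with hs | hs
  · exact (rank_evalMatrix_mul_le_right S g h g.vars.toRight hh (by simp)).trans
      (Nat.pow_le_pow_right two_pos hs)
  · refine (rank_evalMatrix_le_left S (g * h) g.vars.toLeft fun y hy => ?_).trans
      (Nat.pow_le_pow_right two_pos (by omega))
    exact Finset.mem_toLeft.2 ((mem_vars_or_of_mem_vars_mul hy).resolve_right (hh y))

end EvalMatrix

end PCM

namespace PABP

lemma symm_lt_of_partA_eq_inl {n : ℕ} {π : Equiv.Perm (Fin (2 * n))} {x : Fin (2 * n)}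
    {y : Fin n} (h : partA n π x = Sum.inl y) : ((π.symm x : Fin (2 * n)) : ℕ) < n := by
  by_contra hlt
  simp [partA, hlt] at h

lemma le_symm_of_partA_eq_inr {n : ℕ} {π : Equiv.Perm (Fin (2 * n))} {x : Fin (2 * n)}
    {z : Fin n} (h : partA n π x = Sum.inr z) : n ≤ ((π.symm x : Fin (2 * n)) : ℕ) := by
  by_contra hlt
  simp [partA, not_le.1 hlt] at h

end PABP

/-- if `f = Σ_{v=1}^m g_v · h_v` where each summand satisfies condition
(i) (all variables of `g_v` among `x_{π(1)}, …, x_{π(n)}` and `h_v` depends on at most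
`2s` variables) or condition (ii) (all variables of `h_v` among
`x_{π(n+1)}, …, x_{π(2n)}` and `g_v` depends on at most `2s` variables), then for the
partition `A` induced by `π` we have `maxrank(M_{f^A}) ≤ m · 2^s`; in particular, if
`f` is full max-rank for this partition then `m ≥ 2^{n-s}`. -/
theorem partitioned_abp_lower_bound {F : Type} [Field F] (n m s : ℕ) (hs : s ≤ n)
    (π : Equiv.Perm (Fin (2 * n)))
    (f : MvPolynomial (Fin (2 * n)) F) (g h : ℕ → MvPolynomial (Fin (2 * n)) F)
    (hf : f = ∑ v ∈ Finset.range m, g v * h v)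
    (hcond : ∀ v ∈ Finset.range m,
      ((∀ x ∈ (g v).vars, ((π.symm x : Fin (2 * n)) : ℕ) < n) ∧
        (h v).vars.card ≤ 2 * s) ∨
      ((∀ x ∈ (h v).vars, n ≤ ((π.symm x : Fin (2 * n)) : ℕ)) ∧
        (g v).vars.card ≤ 2 * s)) :
    PCM.maxrank (MvPolynomial.rename (PABP.partA n π) f) ≤ m * 2 ^ s ∧
    (PCM.maxrank (MvPolynomial.rename (PABP.partA n π) f) = 2 ^ n → 2 ^ (n - s) ≤ m) := by
  have hcard : ∀ φ : MvPolynomial (Fin (2 * n)) F,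
      (MvPolynomial.rename (PABP.partA n π) φ).vars.card ≤ φ.vars.card := fun φ =>
    (Finset.card_le_card (MvPolynomial.vars_rename _ φ)).trans Finset.card_image_le
  have hmem : ∀ (φ : MvPolynomial (Fin (2 * n)) F) (w : Fin n ⊕ Fin n),
      w ∈ (MvPolynomial.rename (PABP.partA n π) φ).vars →
        ∃ x ∈ φ.vars, PABP.partA n π x = w := fun φ w hw =>
    Finset.mem_image.1 (MvPolynomial.vars_rename _ φ hw)
  have hmain : PCM.maxrank (MvPolynomial.rename (PABP.partA n π) f) ≤ m * 2 ^ s := by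
    refine ciSup_le' fun S => ?_
    change (PCM.evalMatrix S _).rank ≤ _
    rw [hf, map_sum, PCM.evalMatrix_sum]
    refine (PCM.rank_sum_le _ _ (2 ^ s) fun v hv => ?_).trans (by rw [Finset.card_range])
    rw [map_mul]
    rcases hcond v hv with ⟨hg, hh⟩ | ⟨hh, hg⟩
    · refine PCM.rank_evalMatrix_mul_le_of_inl S _ _ s (fun z hz => ?_) ((hcard _).trans hh)
      obtain ⟨x, hx, hxz⟩ := hmem _ _ hz
      exact (hg x hx).not_ge (PABP.le_symm_of_partA_eq_inr hxz)
    · refine PCM.rank_evalMatrix_mul_le_of_inr S _ _ s (fun y hy => ?_) ((hcard _).trans hg)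
      obtain ⟨x, hx, hxy⟩ := hmem _ _ hy
      exact (hh x hx).not_gt (PABP.symm_lt_of_partA_eq_inl hxy)
  refine ⟨hmain, fun hfull => ?_⟩
  rw [hfull, ← Nat.sub_add_cancel hs, pow_add] at hmain
  simpa using Nat.le_of_mul_le_mul_right hmain (by positivity)
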